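/- Let 0 < r < R, let ψ ∈ [0, π], and let P₂(z) = (3z² − 1)/2. For δ in a neighbourhood of 0 define F(δ) = ∫₀^π ∫₀^{2π} ∫₀^{R(1 + δ·P₂(cos α))} s²·sin α · (r² + s² − 2·r·s·(cos ψ·cos α + sin ψ·sin α·cos φ))^{−1/2} ds dφ dα. Then F(0) = 2π·(3R² − r²)/3, and F is differentiable at δ = 0 with F'(0) = (4π/5)·r²·P₂(cos ψ). Consequently, the gravitational potential at an interior point (r, ψ) of a homogeneous body of mass M bounded by the surface s = R(1 + δ·P₂(cos α)) is V_S = −κM·((3R² − r²)/(2R³) + (3/5)·(r²/R³)·δ·P₂(cos ψ)) + o(δ). -/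

import Mathlib

open Asymptotics Filter

/-- The cosine of the angle between the directions with spherical coordinates `(ψ, 0)` and
`(α, φ)`. -/
noncomputable def sphDot (ψ α φ : ℝ) : ℝ :=
  Real.cos ψ * Real.cos α + Real.sin ψ * Real.sin α * Real.cos φ

/-- The derivative of `sphDot` in its first variable. -/
noncomputable def sphDotDeriv (ψ α φ : ℝ) : ℝ :=
  -Real.sin ψ * Real.cos α + Real.cos ψ * Real.sin α * Real.cos φ

theorem sphDot_mem_Icc (ψ α φ : ℝ) : sphDot ψ α φ ∈ Set.Icc (-1 : ℝ) 1 := by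
  have h : sphDot ψ α φ ^ 2 ≤ 1 := by
    unfold sphDot
    have h1 := Real.sin_sq_add_cos_sq ψ
    have h2 := Real.sin_sq_add_cos_sq α
    have h3 := Real.sin_sq_add_cos_sq φ
    have h4 : (Real.cos ψ * Real.cos α + Real.sin ψ * Real.sin α * Real.cos φ) ^ 2
        + (Real.sin ψ * Real.cos α - Real.cos ψ * Real.sin α * Real.cos φ) ^ 2
        + (Real.sin α * Real.sin φ) ^ 2 = 1 := by
      linear_combination (Real.cos α ^ 2 + Real.sin α ^ 2 * Real.cos φ ^ 2) * h1 + h2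
        + Real.sin α ^ 2 * h3
    nlinarith [sq_nonneg (Real.sin ψ * Real.cos α - Real.cos ψ * Real.sin α * Real.cos φ),
      sq_nonneg (Real.sin α * Real.sin φ)]
  exact abs_le.mp ((sq_le_one_iff_abs_le_one _).mp h)

theorem continuous_sphDot : Continuous fun x : ℝ × ℝ × ℝ => sphDot x.1 x.2.1 x.2.2 := by
  unfold sphDot; fun_prop

theorem continuous_sphDotDeriv :
    Continuous fun x : ℝ × ℝ × ℝ => sphDotDeriv x.1 x.2.1 x.2.2 := by
  unfold sphDotDeriv; fun_prop

theorem sphDot_lt_one {ψ α φ : ℝ} (hψ : ψ ∈ Set.Icc 0 Real.pi) (hα : α ∈ Set.Ioo 0 Real.pi)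
    (hφ : φ ∈ Set.Ioo 0 (2 * Real.pi)) : sphDot ψ α φ < 1 := by
  refine lt_of_le_of_ne (sphDot_mem_Icc ψ α φ).2 fun h => ?_
  have hs : 0 < Real.sin α := Real.sin_pos_of_mem_Ioo hα
  have hs' : 0 ≤ Real.sin ψ := Real.sin_nonneg_of_mem_Icc hψ
  have hc : Real.cos φ < 1 := by
    refine lt_of_le_of_ne (Real.cos_le_one φ) fun h => ?_
    rw [Real.cos_eq_one_iff_of_lt_of_lt (by linarith [hφ.1, Real.pi_pos]) hφ.2] at h
    exact hφ.1.ne' h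
  unfold sphDot at h
  have hle : Real.cos ψ * Real.cos α + Real.sin ψ * Real.sin α ≤ 1 := by
    rw [← Real.cos_sub]; exact Real.cos_le_one _
  have h0 : Real.sin ψ = 0 := by
    by_contra hne
    have : 0 < Real.sin ψ * Real.sin α := mul_pos (lt_of_le_of_ne hs' (Ne.symm hne)) hs
    nlinarith
  have h1 := Real.sin_sq_add_cos_sq ψ
  have h2 := Real.sin_sq_add_cos_sq α
  rw [h0] at h h1
  have h3 : (Real.cos ψ * Real.cos α) ^ 2 = 1 := by
    have : Real.cos ψ * Real.cos α = 1 := by linarith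
    rw [this]; norm_num
  nlinarith [mul_pos hs hs]

theorem hasDerivAt_sphDot_fst (ψ α φ : ℝ) :
    HasDerivAt (fun t => sphDot t α φ) (sphDotDeriv ψ α φ) ψ := by
  unfold sphDot sphDotDeriv
  exact ((Real.hasDerivAt_cos ψ).mul_const _).add
    (((Real.hasDerivAt_sin ψ).mul_const _).mul_const _)

theorem hasDerivAt_sphDotDeriv_fst (ψ α φ : ℝ) :
    HasDerivAt (fun t => sphDotDeriv t α φ) (-sphDot ψ α φ) ψ := by
  unfold sphDot sphDotDeriv
  exact (((Real.hasDerivAt_sin ψ).neg.mul_const (Real.cos α)).add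
    (((Real.hasDerivAt_cos ψ).mul_const (Real.sin α)).mul_const (Real.cos φ))).congr_deriv (by ring)

theorem hasDerivAt_sphDot_snd (ψ α φ : ℝ) : HasDerivAt (fun t => sphDot ψ t φ)
    (-Real.cos ψ * Real.sin α + Real.sin ψ * Real.cos α * Real.cos φ) α := by
  unfold sphDot
  exact (((Real.hasDerivAt_cos α).const_mul (Real.cos ψ)).add
    (((Real.hasDerivAt_sin α).const_mul (Real.sin ψ)).mul_const (Real.cos φ))).congr_deriv (by ring)

theorem hasDerivAt_sphDotDeriv_snd (ψ α φ : ℝ) : HasDerivAt (fun t => sphDotDeriv ψ t φ)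
    (Real.sin ψ * Real.sin α + Real.cos ψ * Real.cos α * Real.cos φ) α := by
  unfold sphDotDeriv
  exact (((Real.hasDerivAt_cos α).const_mul (-Real.sin ψ)).add
    (((Real.hasDerivAt_sin α).const_mul (Real.cos ψ)).mul_const (Real.cos φ))).congr_deriv (by ring)

theorem hasDerivAt_sphDot_trd (ψ α φ : ℝ) : HasDerivAt (fun t => sphDot ψ α t)
    (-(Real.sin ψ * Real.sin α * Real.sin φ)) φ := by
  unfold sphDot
  exact (((Real.hasDerivAt_cos φ).const_mul (Real.sin ψ * Real.sin α)).const_add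
    (Real.cos ψ * Real.cos α)).congr_deriv (by ring)

theorem hasDerivAt_sphDotDeriv_trd (ψ α φ : ℝ) : HasDerivAt (fun t => sphDotDeriv ψ α t)
    (-(Real.cos ψ * Real.sin α * Real.sin φ)) φ := by
  unfold sphDotDeriv
  exact (((Real.hasDerivAt_cos φ).const_mul (Real.cos ψ * Real.sin α)).const_add
    (-Real.sin ψ * Real.cos α)).congr_deriv (by ring)

theorem intervalIntegral_swap_of_continuous {f : ℝ → ℝ → ℝ}
    (hf : Continuous (Function.uncurry f)) (a b c d : ℝ) :
    ∫ x in a..b, ∫ y in c..d, f x y = ∫ y in c..d, ∫ x in a..b, f x y := by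
  refine MeasureTheory.intervalIntegral_intervalIntegral_swap ?_
  refine (hf.continuousOn.integrableOn_compact
    (isCompact_uIcc (a := a) (b := b) |>.prod (isCompact_uIcc (a := c) (b := d)))).mono_set ?_
  exact Set.prod_mono Set.uIoc_subset_uIcc Set.uIoc_subset_uIcc

section rotation

variable {H Hu Hw : ℝ → ℝ → ℝ}

/-- Rotating the sphere does not change the integral of a smooth function over it: infinitesimal
version. -/
theorem integral_sphere_infinitesimal_rotation
    (hu : Continuous fun x : ℝ × ℝ × ℝ =>
      Hu (sphDot x.1 x.2.1 x.2.2) (sphDotDeriv x.1 x.2.1 x.2.2))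
    (hw : Continuous fun x : ℝ × ℝ × ℝ =>
      Hw (sphDot x.1 x.2.1 x.2.2) (sphDotDeriv x.1 x.2.1 x.2.2))
    (hc : Continuous fun x : ℝ × ℝ × ℝ =>
      H (sphDot x.1 x.2.1 x.2.2) (sphDotDeriv x.1 x.2.1 x.2.2))
    (hH : ∀ (x y : ℝ → ℝ) (x' y' t : ℝ), x t ∈ Set.Icc (-1 : ℝ) 1 → HasDerivAt x x' t →
      HasDerivAt y y' t →
      HasDerivAt (fun t => H (x t) (y t)) (Hu (x t) (y t) * x' + Hw (x t) (y t) * y') t)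
    (ψ : ℝ) :
    ∫ α in (0 : ℝ)..Real.pi, ∫ φ in (0 : ℝ)..(2 * Real.pi),
      (Hu (sphDot ψ α φ) (sphDotDeriv ψ α φ) * sphDotDeriv ψ α φ
        + Hw (sphDot ψ α φ) (sphDotDeriv ψ α φ) * -sphDot ψ α φ) * Real.sin α = 0 := by
  have hi : Continuous fun x : ℝ × ℝ => ((ψ, x.1, x.2) : ℝ × ℝ × ℝ) := by fun_prop
  have hu2 := hu.comp hi
  have hw2 := hw.comp hi
  have hc2 := hc.comp hi
  simp only [Function.comp_def] at hu2 hw2 hc2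
  let A : ℝ → ℝ → ℝ := fun α φ =>
    Real.cos φ * Real.cos α * H (sphDot ψ α φ) (sphDotDeriv ψ α φ) + Real.cos φ * Real.sin α *
      (Hu (sphDot ψ α φ) (sphDotDeriv ψ α φ) *
          (-Real.cos ψ * Real.sin α + Real.sin ψ * Real.cos α * Real.cos φ) +
        Hw (sphDot ψ α φ) (sphDotDeriv ψ α φ) *
          (Real.sin ψ * Real.sin α + Real.cos ψ * Real.cos α * Real.cos φ))
  let B : ℝ → ℝ → ℝ := fun α φ =>
    Real.cos α * Real.cos φ * H (sphDot ψ α φ) (sphDotDeriv ψ α φ) + Real.cos α * Real.sin φ *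
      (Hu (sphDot ψ α φ) (sphDotDeriv ψ α φ) * (-(Real.sin ψ * Real.sin α * Real.sin φ)) +
        Hw (sphDot ψ α φ) (sphDotDeriv ψ α φ) * (-(Real.cos ψ * Real.sin α * Real.sin φ)))
  have hA : Continuous (Function.uncurry A) := by
    exact Continuous.add (Continuous.mul (by fun_prop) hc2) (Continuous.mul (by fun_prop)
      ((hu2.mul (by fun_prop)).add (hw2.mul (by fun_prop))))
  have hB : Continuous (Function.uncurry B) := by
    exact Continuous.add (Continuous.mul (by fun_prop) hc2) (Continuous.mul (by fun_prop)
      ((hu2.mul (by fun_prop)).add (hw2.mul (by fun_prop))))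
  have hA1 : ∀ φ, Continuous fun α => A α φ := fun φ => hA.uncurry_right φ
  have hA2 : ∀ α, Continuous fun φ => A α φ := fun α => hA.uncurry_left α
  have hB2 : ∀ α, Continuous fun φ => B α φ := fun α => hB.uncurry_left α
  have hBA : ∀ α φ, (Hu (sphDot ψ α φ) (sphDotDeriv ψ α φ) * sphDotDeriv ψ α φ
        + Hw (sphDot ψ α φ) (sphDotDeriv ψ α φ) * -sphDot ψ α φ) * Real.sin α
        = B α φ - A α φ := by
    intro α φ
    simp only [A, B]
    generalize Hu (sphDot ψ α φ) (sphDotDeriv ψ α φ) = p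
    generalize Hw (sphDot ψ α φ) (sphDotDeriv ψ α φ) = q
    unfold sphDot sphDotDeriv
    linear_combination (Real.sin α * Real.cos α * (p * Real.sin ψ + q * Real.cos ψ)) *
      Real.sin_sq_add_cos_sq φ
  have hBz : ∀ α, ∫ φ in (0 : ℝ)..(2 * Real.pi), B α φ = 0 := by
    intro α
    rw [intervalIntegral.integral_eq_sub_of_hasDerivAt
      (f := fun φ => Real.cos α * Real.sin φ * H (sphDot ψ α φ) (sphDotDeriv ψ α φ)) _
      ((hB2 α).intervalIntegrable _ _)]
    · simp
    · intro φ _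
      exact ((Real.hasDerivAt_sin φ).const_mul (Real.cos α)).mul
        (hH _ _ _ _ φ (sphDot_mem_Icc _ _ _) (hasDerivAt_sphDot_trd ψ α φ)
          (hasDerivAt_sphDotDeriv_trd ψ α φ))
  have hAz : ∀ φ, ∫ α in (0 : ℝ)..Real.pi, A α φ = 0 := by
    intro φ
    rw [intervalIntegral.integral_eq_sub_of_hasDerivAt
      (f := fun α => Real.cos φ * Real.sin α * H (sphDot ψ α φ) (sphDotDeriv ψ α φ)) _
      ((hA1 φ).intervalIntegrable _ _)]
    · simp
    · intro α _
      exact ((Real.hasDerivAt_sin α).const_mul (Real.cos φ)).mul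
        (hH (fun α => sphDot ψ α φ) (fun α => sphDotDeriv ψ α φ) _ _ α (sphDot_mem_Icc _ _ _)
          (hasDerivAt_sphDot_snd ψ α φ) (hasDerivAt_sphDotDeriv_snd ψ α φ))
  have hsub : ∀ α, ∫ φ in (0 : ℝ)..(2 * Real.pi), (B α φ - A α φ)
      = -∫ φ in (0 : ℝ)..(2 * Real.pi), A α φ := by
    intro α
    rw [intervalIntegral.integral_sub ((hB2 α).intervalIntegrable _ _)
      ((hA2 α).intervalIntegrable _ _), hBz, zero_sub]
  simp only [hBA, hsub, intervalIntegral.integral_neg]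
  rw [intervalIntegral_swap_of_continuous hA]
  simp [hAz]

/-- Rotating the sphere does not change the integral of a smooth function over it. -/
theorem integral_sphere_rotation
    (hu : Continuous fun x : ℝ × ℝ × ℝ =>
      Hu (sphDot x.1 x.2.1 x.2.2) (sphDotDeriv x.1 x.2.1 x.2.2))
    (hw : Continuous fun x : ℝ × ℝ × ℝ =>
      Hw (sphDot x.1 x.2.1 x.2.2) (sphDotDeriv x.1 x.2.1 x.2.2))
    (hc : Continuous fun x : ℝ × ℝ × ℝ =>
      H (sphDot x.1 x.2.1 x.2.2) (sphDotDeriv x.1 x.2.1 x.2.2))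
    (hH : ∀ (x y : ℝ → ℝ) (x' y' t : ℝ), x t ∈ Set.Icc (-1 : ℝ) 1 → HasDerivAt x x' t →
      HasDerivAt y y' t →
      HasDerivAt (fun t => H (x t) (y t)) (Hu (x t) (y t) * x' + Hw (x t) (y t) * y') t)
    (ψ : ℝ) :
    ∫ α in (0 : ℝ)..Real.pi, ∫ φ in (0 : ℝ)..(2 * Real.pi),
      H (sphDot ψ α φ) (sphDotDeriv ψ α φ) * Real.sin α =
    ∫ α in (0 : ℝ)..Real.pi, ∫ φ in (0 : ℝ)..(2 * Real.pi),
      H (Real.cos α) (Real.sin α * Real.cos φ) * Real.sin α := by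
  let D : ℝ → ℝ → ℝ → ℝ := fun t α φ =>
    (Hu (sphDot t α φ) (sphDotDeriv t α φ) * sphDotDeriv t α φ
        + Hw (sphDot t α φ) (sphDotDeriv t α φ) * -sphDot t α φ) * Real.sin α
  have hD : Continuous fun x : ℝ × ℝ × ℝ => D x.1 x.2.1 x.2.2 := by
    exact ((hu.mul continuous_sphDotDeriv).add (hw.mul continuous_sphDot.neg)).mul
      (by fun_prop)
  let K : ℝ → ℝ → ℝ → ℝ := fun t α φ => H (sphDot t α φ) (sphDotDeriv t α φ) * Real.sin α
  have hK : Continuous fun x : ℝ × ℝ × ℝ => K x.1 x.2.1 x.2.2 := by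
    exact hc.mul (by fun_prop)
  have hK2 : ∀ t, Continuous (Function.uncurry (K t)) := fun t =>
    hK.comp (f := fun x : ℝ × ℝ => ((t, x.1, x.2) : ℝ × ℝ × ℝ)) (by fun_prop)
  have hK3 : ∀ t α, Continuous (K t α) := fun t α =>
    hK.comp (f := fun φ : ℝ => ((t, α, φ) : ℝ × ℝ × ℝ)) (by fun_prop)
  have hKI : ∀ t, Continuous fun α => ∫ φ in (0 : ℝ)..(2 * Real.pi), K t α φ := fun t =>
    intervalIntegral.continuous_parametric_intervalIntegral_of_continuous' (hK2 t) _ _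
  have h0 : ∀ α φ, H (Real.cos α) (Real.sin α * Real.cos φ) * Real.sin α = K 0 α φ := by
    intro α φ; simp [K, sphDot, sphDotDeriv]
  have hFTC : ∀ α φ, K ψ α φ - K 0 α φ = ∫ t in (0 : ℝ)..ψ, D t α φ := by
    intro α φ
    rw [intervalIntegral.integral_eq_sub_of_hasDerivAt (f := fun t => K t α φ)]
    · intro t _
      exact (hH (fun t => sphDot t α φ) (fun t => sphDotDeriv t α φ) _ _ t (sphDot_mem_Icc _ _ _)
        (hasDerivAt_sphDot_fst t α φ) (hasDerivAt_sphDotDeriv_fst t α φ)).mul_const _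
    · exact (hD.comp (f := fun t : ℝ => ((t, α, φ) : ℝ × ℝ × ℝ)) (by fun_prop)).intervalIntegrable _ _
  simp only [h0]
  rw [← sub_eq_zero]
  change (∫ α in (0 : ℝ)..Real.pi, ∫ φ in (0 : ℝ)..(2 * Real.pi), K ψ α φ) - _ = 0
  rw [← intervalIntegral.integral_sub ((hKI ψ).intervalIntegrable _ _)
    ((hKI 0).intervalIntegrable _ _)]
  have h1 : ∀ α, (∫ φ in (0 : ℝ)..(2 * Real.pi), K ψ α φ) - (∫ φ in (0 : ℝ)..(2 * Real.pi), K 0 α φ)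
      = ∫ t in (0 : ℝ)..ψ, ∫ φ in (0 : ℝ)..(2 * Real.pi), D t α φ := by
    intro α
    rw [← intervalIntegral.integral_sub ((hK3 ψ α).intervalIntegrable _ _)
      ((hK3 0 α).intervalIntegrable _ _)]
    simp only [hFTC]
    exact intervalIntegral_swap_of_continuous (f := fun φ t => D t α φ)
      (hD.comp (f := fun x : ℝ × ℝ => ((x.2, α, x.1) : ℝ × ℝ × ℝ)) (by fun_prop)) _ _ _ _
  simp only [h1]
  rw [intervalIntegral_swap_of_continuous
    (f := fun α t => ∫ φ in (0 : ℝ)..(2 * Real.pi), D t α φ)]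
  · simp only [D, integral_sphere_infinitesimal_rotation hu hw hc hH, intervalIntegral.integral_zero]
  · exact intervalIntegral.continuous_parametric_intervalIntegral_of_continuous'
      (f := fun (x : ℝ × ℝ) φ => D x.2 x.1 φ)
      (hD.comp (f := fun x : (ℝ × ℝ) × ℝ =>
        ((x.1.2, x.1.1, x.2) : ℝ × ℝ × ℝ)) (by fun_prop)) _ _

end rotation

theorem integral_sphere_zonal_mul_sq {f f' : ℝ → ℝ}
    (hf : ∀ x ∈ Set.Icc (-1 : ℝ) 1, HasDerivAt f (f' x) x)
    (hf' : ContinuousOn f' (Set.Icc (-1 : ℝ) 1)) (p q a b ψ : ℝ) :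
    ∫ α in (0 : ℝ)..Real.pi, ∫ φ in (0 : ℝ)..(2 * Real.pi),
      f (sphDot ψ α φ) * (p + q * (a * sphDot ψ α φ + b * sphDotDeriv ψ α φ) ^ 2) * Real.sin α =
    ∫ z in (-1 : ℝ)..1,
      f z * (2 * Real.pi * p + Real.pi * q * (2 * a ^ 2 * z ^ 2 + b ^ 2 * (1 - z ^ 2))) := by
  have hfc : ContinuousOn f (Set.Icc (-1 : ℝ) 1) := fun x hx =>
    (hf x hx).continuousAt.continuousWithinAt
  have hu := continuous_sphDot
  have hw := continuous_sphDotDeriv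
  have h1 : Continuous fun x : ℝ × ℝ × ℝ => f (sphDot x.1 x.2.1 x.2.2) :=
    hfc.comp_continuous hu fun _ => sphDot_mem_Icc _ _ _
  have h2 : Continuous fun x : ℝ × ℝ × ℝ => f' (sphDot x.1 x.2.1 x.2.2) :=
    hf'.comp_continuous hu fun _ => sphDot_mem_Icc _ _ _
  have hl : Continuous fun x : ℝ × ℝ × ℝ =>
      a * sphDot x.1 x.2.1 x.2.2 + b * sphDotDeriv x.1 x.2.1 x.2.2 :=
    (hu.const_mul a).add (hw.const_mul b)
  have hp : Continuous fun x : ℝ × ℝ × ℝ =>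
      p + q * (a * sphDot x.1 x.2.1 x.2.2 + b * sphDotDeriv x.1 x.2.1 x.2.2) ^ 2 :=
    ((hl.pow 2).const_mul q).const_add p
  have key := integral_sphere_rotation
    (H := fun u w => f u * (p + q * (a * u + b * w) ^ 2))
    (Hu := fun u w => f' u * (p + q * (a * u + b * w) ^ 2) + f u * (2 * q * (a * u + b * w) * a))
    (Hw := fun u w => f u * (2 * q * (a * u + b * w) * b))
    ((h2.mul hp).add (h1.mul ((hl.const_mul (2 * q)).mul_const a)))
    (h1.mul ((hl.const_mul (2 * q)).mul_const b)) (h1.mul hp)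
    (by
      intro x y x' y' t ht hx hy
      exact (((hf _ ht).comp t hx).mul (((((hx.const_mul a).add (hy.const_mul b)).pow 2).const_mul
        q).const_add p)).congr_deriv (by simp; ring)) ψ
  rw [key]
  have hin : ∀ α, ∫ φ in (0 : ℝ)..(2 * Real.pi), f (Real.cos α) *
      (p + q * (a * Real.cos α + b * (Real.sin α * Real.cos φ)) ^ 2) * Real.sin α =
      f (Real.cos α) * (2 * Real.pi * p + Real.pi * q *
        (2 * a ^ 2 * Real.cos α ^ 2 + b ^ 2 * (1 - Real.cos α ^ 2))) * Real.sin α := by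
    intro α
    have e : ∀ φ, f (Real.cos α) *
        (p + q * (a * Real.cos α + b * (Real.sin α * Real.cos φ)) ^ 2) * Real.sin α =
        f (Real.cos α) * (p + q * a ^ 2 * Real.cos α ^ 2) * Real.sin α +
        f (Real.cos α) * Real.sin α * (2 * q * a * b * Real.cos α * Real.sin α) * Real.cos φ +
        f (Real.cos α) * Real.sin α * (q * b ^ 2 * Real.sin α ^ 2) * Real.cos φ ^ 2 := by
      intro φ; ring
    simp only [e]
    rw [intervalIntegral.integral_add, intervalIntegral.integral_add,
      intervalIntegral.integral_const, intervalIntegral.integral_const_mul,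
      intervalIntegral.integral_const_mul, integral_cos, integral_cos_sq]
    · simp only [Real.sin_two_pi, Real.sin_zero, smul_eq_mul, Real.sin_sq]
      ring
    all_goals exact Continuous.intervalIntegrable (by fun_prop) _ _
  simp only [hin]
  have hsub := intervalIntegral.integral_comp_mul_deriv' (a := 0) (b := Real.pi)
    (f := Real.cos) (f' := fun x => -Real.sin x)
    (g := fun z => f z * (2 * Real.pi * p + Real.pi * q *
      (2 * a ^ 2 * z ^ 2 + b ^ 2 * (1 - z ^ 2))))
    (fun x _ => Real.hasDerivAt_cos x) (by fun_prop)
    ((hfc.mul (by fun_prop)).mono (by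
      rintro _ ⟨x, _, rfl⟩; exact ⟨Real.neg_one_le_cos x, Real.cos_le_one x⟩))
  rw [Real.cos_zero, Real.cos_pi, intervalIntegral.integral_symm (-1) 1] at hsub
  rw [← neg_inj, ← hsub, ← intervalIntegral.integral_neg]
  simp

section kernel

variable {r s : ℝ}

theorem dist_sq_pos (hr : 0 < r) (hs : 0 < s) (hrs : r ≠ s) {x : ℝ}
    (hx : x ∈ Set.Icc (-1 : ℝ) 1) : 0 < r ^ 2 + s ^ 2 - 2 * r * s * x := by
  have : 0 < (r - s) ^ 2 := by have := sub_ne_zero.mpr hrs; positivity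
  nlinarith [mul_pos hr hs, hx.2]

theorem hasDerivAt_sqrt_dist_sq {x : ℝ} (h : 0 < r ^ 2 + s ^ 2 - 2 * r * s * x) :
    HasDerivAt (fun x => Real.sqrt (r ^ 2 + s ^ 2 - 2 * r * s * x))
      (-(r * s) / Real.sqrt (r ^ 2 + s ^ 2 - 2 * r * s * x)) x := by
  have h1 : HasDerivAt (fun x => r ^ 2 + s ^ 2 - 2 * r * s * x) (-(2 * r * s * 1)) x :=
    ((hasDerivAt_id x).const_mul (2 * r * s)).const_sub (r ^ 2 + s ^ 2)
  refine (h1.sqrt h.ne').congr_deriv ?_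
  have := Real.sqrt_pos.mpr h
  field_simp

theorem continuousOn_inv_dist (hr : 0 < r) (hs : 0 < s) (hrs : r ≠ s) :
    ContinuousOn (fun x => 1 / Real.sqrt (r ^ 2 + s ^ 2 - 2 * r * s * x)) (Set.Icc (-1) 1) :=
  ContinuousOn.div₀ (by fun_prop) (by fun_prop)
    fun x hx => (Real.sqrt_pos.mpr (dist_sq_pos hr hs hrs hx)).ne'

theorem hasDerivAt_inv_dist (hr : 0 < r) (hs : 0 < s) (hrs : r ≠ s) {x : ℝ}
    (hx : x ∈ Set.Icc (-1 : ℝ) 1) :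
    HasDerivAt (fun x => 1 / Real.sqrt (r ^ 2 + s ^ 2 - 2 * r * s * x))
      (r * s * (1 / Real.sqrt (r ^ 2 + s ^ 2 - 2 * r * s * x)) ^ 3) x := by
  have h := dist_sq_pos hr hs hrs hx
  have h0 := Real.sqrt_pos.mpr h
  have := (hasDerivAt_sqrt_dist_sq h).fun_inv h0.ne'
  simp only [one_div]
  refine this.congr_deriv ?_
  field_simp

theorem sqrt_dist_sq_neg_one (hr : 0 < r) (hs : 0 < s) :
    Real.sqrt (r ^ 2 + s ^ 2 - 2 * r * s * (-1)) = r + s := by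
  rw [show r ^ 2 + s ^ 2 - 2 * r * s * (-1) = (r + s) ^ 2 by ring, Real.sqrt_sq (by positivity)]

theorem sqrt_dist_sq_one : Real.sqrt (r ^ 2 + s ^ 2 - 2 * r * s * 1) = |r - s| := by
  rw [show r ^ 2 + s ^ 2 - 2 * r * s * 1 = (r - s) ^ 2 by ring, Real.sqrt_sq_eq_abs]

theorem integral_inv_dist (hr : 0 < r) (hs : 0 < s) (hrs : r ≠ s) :
    ∫ z in (-1 : ℝ)..1, 1 / Real.sqrt (r ^ 2 + s ^ 2 - 2 * r * s * z) = 2 / max r s := by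
  rw [intervalIntegral.integral_eq_sub_of_hasDerivAt
    (f := fun z => -(1 / (r * s)) * Real.sqrt (r ^ 2 + s ^ 2 - 2 * r * s * z))]
  · rw [sqrt_dist_sq_neg_one hr hs, sqrt_dist_sq_one]
    rcases le_total r s with h | h
    · rw [max_eq_right h, abs_of_nonpos (by linarith)]; field_simp; ring
    · rw [max_eq_left h, abs_of_nonneg (by linarith)]; field_simp; ring
  · intro x hx
    rw [Set.uIcc_of_le (by norm_num)] at hx
    have h := dist_sq_pos hr hs hrs hx
    have h0 := Real.sqrt_pos.mpr h
    refine ((hasDerivAt_sqrt_dist_sq h).const_mul _).congr_deriv ?_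
    field_simp
  · refine ContinuousOn.intervalIntegrable ?_
    rw [Set.uIcc_of_le (by norm_num)]
    exact continuousOn_inv_dist hr hs hrs

theorem integral_inv_dist_mul_legendre_two (hr : 0 < r) (hrs : r < s) :
    ∫ z in (-1 : ℝ)..1, 1 / Real.sqrt (r ^ 2 + s ^ 2 - 2 * r * s * z) * ((3 * z ^ 2 - 1) / 2)
      = 2 / 5 * (r ^ 2 / s ^ 3) := by
  have hs : 0 < s := hr.trans hrs
  let G : ℝ → ℝ := fun D => -(1 / (r * s)) * (3 / (8 * r ^ 2 * s ^ 2) *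
    ((r ^ 2 + s ^ 2) ^ 2 * D - 2 * (r ^ 2 + s ^ 2) / 3 * D ^ 3 + D ^ 5 / 5) - D / 2)
  rw [intervalIntegral.integral_eq_sub_of_hasDerivAt
    (f := fun z => G (Real.sqrt (r ^ 2 + s ^ 2 - 2 * r * s * z)))]
  · rw [sqrt_dist_sq_neg_one hr hs, sqrt_dist_sq_one, abs_of_nonpos (by linarith)]
    simp only [G]
    field_simp
    ring
  · intro x hx
    rw [Set.uIcc_of_le (by norm_num)] at hx
    have h := dist_sq_pos hr hs hrs.ne hx
    have h0 := Real.sqrt_pos.mpr h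
    have hG : ∀ D, HasDerivAt G (-(1 / (r * s)) * (3 / (8 * r ^ 2 * s ^ 2) *
        ((r ^ 2 + s ^ 2) ^ 2 - 2 * (r ^ 2 + s ^ 2) * D ^ 2 + D ^ 4) - 1 / 2)) D := by
      intro D
      have hD := hasDerivAt_id D
      refine (((((((hD.const_mul ((r ^ 2 + s ^ 2) ^ 2)).sub
        ((hD.pow 3).const_mul (2 * (r ^ 2 + s ^ 2) / 3))).add
        ((hD.pow 5).div_const 5)).const_mul (3 / (8 * r ^ 2 * s ^ 2))).sub
        (hD.div_const 2)).const_mul (-(1 / (r * s))))).congr_deriv ?_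
      simp only [id_eq]
      push_cast
      ring
    refine ((hG _).comp x (hasDerivAt_sqrt_dist_sq h)).congr_deriv ?_
    have hsq := Real.sq_sqrt h.le
    have hsq4 : Real.sqrt (r ^ 2 + s ^ 2 - 2 * r * s * x) ^ 4
        = (r ^ 2 + s ^ 2 - 2 * r * s * x) ^ 2 := by
      rw [show 4 = 2 * 2 from rfl, pow_mul, hsq]
    rw [hsq4, hsq]
    field_simp
    ring
  · refine ContinuousOn.intervalIntegrable ?_
    rw [Set.uIcc_of_le (by norm_num)]
    exact (continuousOn_inv_dist hr hs hrs.ne).mul (by fun_prop)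

/-- The mean value of the inverse distance over a sphere. -/
theorem integral_sphere_inv_dist (hr : 0 < r) (hs : 0 < s) (hrs : r ≠ s) (ψ : ℝ) :
    ∫ α in (0 : ℝ)..Real.pi, ∫ φ in (0 : ℝ)..(2 * Real.pi),
      Real.sin α / Real.sqrt (r ^ 2 + s ^ 2 - 2 * r * s * sphDot ψ α φ) =
    4 * Real.pi / max r s := by
  have key := integral_sphere_zonal_mul_sq (fun x hx => hasDerivAt_inv_dist hr hs hrs hx)
    (((continuousOn_inv_dist hr hs hrs).pow 3).const_mul (r * s)) 1 0 0 0 ψ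
  have e : ∀ α φ, Real.sin α / Real.sqrt (r ^ 2 + s ^ 2 - 2 * r * s * sphDot ψ α φ) =
      1 / Real.sqrt (r ^ 2 + s ^ 2 - 2 * r * s * sphDot ψ α φ) *
        (1 + 0 * (0 * sphDot ψ α φ + 0 * sphDotDeriv ψ α φ) ^ 2) * Real.sin α := by
    intro α φ; ring
  simp only [e]
  rw [key, intervalIntegral.integral_congr (g := fun z =>
    2 * Real.pi * (1 / Real.sqrt (r ^ 2 + s ^ 2 - 2 * r * s * z))) (fun z _ => by simp; ring),
    intervalIntegral.integral_const_mul, integral_inv_dist hr hs hrs]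
  ring

/-- The second Legendre moment of the inverse distance over a sphere. -/
theorem integral_sphere_inv_dist_mul_legendre_two (hr : 0 < r) (hrs : r < s) (ψ : ℝ) :
    ∫ α in (0 : ℝ)..Real.pi, ∫ φ in (0 : ℝ)..(2 * Real.pi),
      Real.sin α / Real.sqrt (r ^ 2 + s ^ 2 - 2 * r * s * sphDot ψ α φ) *
        ((3 * Real.cos α ^ 2 - 1) / 2) =
    4 * Real.pi / 5 * (r ^ 2 / s ^ 3) * ((3 * Real.cos ψ ^ 2 - 1) / 2) := by
  have hs : 0 < s := hr.trans hrs
  have key := integral_sphere_zonal_mul_sq (fun x hx => hasDerivAt_inv_dist hr hs hrs.ne hx)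
    (((continuousOn_inv_dist hr hs hrs.ne).pow 3).const_mul (r * s))
    (-1 / 2) (3 / 2) (Real.cos ψ) (-Real.sin ψ) ψ
  have e : ∀ α φ, Real.sin α / Real.sqrt (r ^ 2 + s ^ 2 - 2 * r * s * sphDot ψ α φ) *
        ((3 * Real.cos α ^ 2 - 1) / 2) =
      1 / Real.sqrt (r ^ 2 + s ^ 2 - 2 * r * s * sphDot ψ α φ) *
        (-1 / 2 + 3 / 2 * (Real.cos ψ * sphDot ψ α φ + -Real.sin ψ * sphDotDeriv ψ α φ) ^ 2) *
        Real.sin α := by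
    intro α φ
    have : Real.cos ψ * sphDot ψ α φ + -Real.sin ψ * sphDotDeriv ψ α φ = Real.cos α := by
      unfold sphDot sphDotDeriv
      linear_combination Real.cos α * Real.sin_sq_add_cos_sq ψ
    rw [this]; ring
  simp only [e]
  rw [key, intervalIntegral.integral_congr (g := fun z =>
    2 * Real.pi * ((3 * Real.cos ψ ^ 2 - 1) / 2) *
      (1 / Real.sqrt (r ^ 2 + s ^ 2 - 2 * r * s * z) * ((3 * z ^ 2 - 1) / 2)))
    (fun z _ => by simp only [neg_sq, Real.sin_sq]; ring),
    intervalIntegral.integral_const_mul, integral_inv_dist_mul_legendre_two hr hrs]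
  ring

end kernel

open MeasureTheory in
/-- Lebesgue measure on the rectangle of angles `(α, φ)`. -/
noncomputable def angleMeasure : Measure (ℝ × ℝ) :=
  (volume.restrict (Set.Ioc 0 Real.pi)).prod (volume.restrict (Set.Ioc 0 (2 * Real.pi)))

/-- The Newtonian integrand in spherical coordinates. -/
noncomputable def newtonKernel (r ψ s : ℝ) (x : ℝ × ℝ) : ℝ :=
  s ^ 2 * Real.sin x.1 / Real.sqrt (r ^ 2 + s ^ 2 - 2 * r * s * sphDot ψ x.1 x.2)

section potential

open MeasureTheory

theorem angleMeasure_eq_restrict : angleMeasure =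
    (volume : Measure (ℝ × ℝ)).restrict (Set.Ioc 0 Real.pi ×ˢ Set.Ioc 0 (2 * Real.pi)) := by
  rw [angleMeasure, Measure.prod_restrict, Measure.volume_eq_prod]

instance : IsFiniteMeasure angleMeasure := by
  unfold angleMeasure; infer_instance

theorem ae_angleMeasure : ∀ᵐ x ∂angleMeasure,
    x.1 ∈ Set.Ioo 0 Real.pi ∧ x.2 ∈ Set.Ioo 0 (2 * Real.pi) := by
  rw [angleMeasure, ← restrict_Ioo_eq_restrict_Ioc, ← restrict_Ioo_eq_restrict_Ioc,
    Measure.prod_restrict]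
  filter_upwards [ae_restrict_mem (measurableSet_Ioo.prod measurableSet_Ioo)] with x hx
  exact hx

theorem integrable_angleMeasure_of_continuous {g : ℝ × ℝ → ℝ} (hg : Continuous g) :
    Integrable g angleMeasure := by
  rw [angleMeasure_eq_restrict]
  exact (hg.continuousOn.integrableOn_compact (isCompact_Icc.prod isCompact_Icc)).mono_set
    (Set.prod_mono Set.Ioc_subset_Icc_self Set.Ioc_subset_Icc_self)

theorem integral_angleMeasure {g : ℝ × ℝ → ℝ} (hg : Integrable g angleMeasure) :
    ∫ x, g x ∂angleMeasure =
      ∫ α in (0 : ℝ)..Real.pi, ∫ φ in (0 : ℝ)..(2 * Real.pi), g (α, φ) := by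
  rw [intervalIntegral.integral_of_le Real.pi_pos.le]
  simp only [intervalIntegral.integral_of_le Real.two_pi_pos.le]
  exact integral_prod g hg

variable {r ψ : ℝ}

theorem sub_sq_le_dist_sq {s : ℝ} (hr : 0 < r) (hs : 0 ≤ s) (α φ : ℝ) :
    (s - r) ^ 2 ≤ r ^ 2 + s ^ 2 - 2 * r * s * sphDot ψ α φ := by
  nlinarith [mul_nonneg hr.le hs, (sphDot_mem_Icc ψ α φ).2]

theorem dist_sq_pos_of_lt_one {s u : ℝ} (hr : 0 < r) (hs : 0 ≤ s) (hu : u < 1) :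
    0 < r ^ 2 + s ^ 2 - 2 * r * s * u := by
  rcases hs.eq_or_lt with rfl | hs
  · simpa using pow_pos hr 2
  · nlinarith [mul_pos (mul_pos hr hs) (sub_pos.mpr hu), sq_nonneg (r - s)]

theorem measurable_newtonKernel :
    Measurable fun z : (ℝ × ℝ) × ℝ => newtonKernel r ψ z.2 z.1 := by
  have h : Continuous fun z : (ℝ × ℝ) × ℝ => sphDot ψ z.1.1 z.1.2 :=
    continuous_sphDot.comp (f := fun z : (ℝ × ℝ) × ℝ => (ψ, z.1.1, z.1.2)) (by fun_prop)
  have h1 : Continuous fun z : (ℝ × ℝ) × ℝ =>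
      Real.sqrt (r ^ 2 + z.2 ^ 2 - 2 * r * z.2 * sphDot ψ z.1.1 z.1.2) :=
    (Continuous.sub (by fun_prop) (Continuous.mul (by fun_prop) h)).sqrt
  have h2 : Continuous fun z : (ℝ × ℝ) × ℝ => z.2 ^ 2 * Real.sin z.1.1 := by fun_prop
  exact h2.measurable.div h1.measurable

theorem newtonKernel_nonneg (s : ℝ) {x : ℝ × ℝ} (hx : x.1 ∈ Set.Ioo 0 Real.pi) :
    0 ≤ newtonKernel r ψ s x :=
  div_nonneg (mul_nonneg (sq_nonneg s) (Real.sin_pos_of_mem_Ioo hx).le) (Real.sqrt_nonneg _)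

theorem continuous_newtonKernel {s : ℝ} (hr : 0 < r) (hs : 0 < s) (hrs : r ≠ s) :
    Continuous (newtonKernel r ψ s) := by
  have h : Continuous fun x : ℝ × ℝ => sphDot ψ x.1 x.2 :=
    continuous_sphDot.comp (f := fun x : ℝ × ℝ => (ψ, x.1, x.2)) (by fun_prop)
  exact Continuous.div (by fun_prop) (continuous_const.sub (h.const_mul _)).sqrt
    fun x => (Real.sqrt_pos.mpr (dist_sq_pos hr hs hrs (sphDot_mem_Icc _ _ _))).ne'

theorem continuousAt_newtonKernel_radius {s : ℝ} {x : ℝ × ℝ} (hr : 0 < r) (hs : 0 ≤ s)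
    (hx : sphDot ψ x.1 x.2 < 1) : ContinuousAt (fun s => newtonKernel r ψ s x) s :=
  ContinuousAt.div (by fun_prop) (by fun_prop)
    (Real.sqrt_pos.mpr (dist_sq_pos_of_lt_one hr hs hx)).ne'

theorem intervalIntegrable_newtonKernel {B : ℝ} {x : ℝ × ℝ} (hr : 0 < r) (hB : 0 ≤ B)
    (hx : sphDot ψ x.1 x.2 < 1) :
    IntervalIntegrable (fun s => newtonKernel r ψ s x) volume 0 B := by
  refine ContinuousOn.intervalIntegrable fun s hs => ?_
  rw [Set.uIcc_of_le hB] at hs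
  exact (continuousAt_newtonKernel_radius hr hs.1 hx).continuousWithinAt

theorem integral_newtonKernel_angle {s : ℝ} (hr : 0 < r) (hs : 0 < s) (hrs : r ≠ s) :
    ∫ x, newtonKernel r ψ s x ∂angleMeasure = 4 * Real.pi * (s ^ 2 / max r s) := by
  rw [integral_angleMeasure (integrable_angleMeasure_of_continuous
    (continuous_newtonKernel hr hs hrs))]
  have e : ∀ α φ, newtonKernel r ψ s (α, φ) =
      s ^ 2 * (Real.sin α / Real.sqrt (r ^ 2 + s ^ 2 - 2 * r * s * sphDot ψ α φ)) := by
    intro α φ; unfold newtonKernel; ring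
  simp only [e, intervalIntegral.integral_const_mul, integral_sphere_inv_dist hr hs hrs]
  ring

theorem ae_radius (B : ℝ) :
    ∀ᵐ s ∂(volume : Measure ℝ).restrict (Set.Ioc 0 B), 0 < s ∧ r ≠ s := by
  filter_upwards [ae_restrict_mem measurableSet_Ioc, ae_restrict_of_ae (Measure.ae_ne volume r)]
    with s hs hsr
  exact ⟨hs.1, hsr.symm⟩

theorem continuous_sq_div_max (hr : 0 < r) : Continuous fun s : ℝ => s ^ 2 / max r s :=
  Continuous.div (by fun_prop) (by fun_prop) fun _ => (lt_max_of_lt_left hr).ne'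

theorem integrable_newtonKernel (hr : 0 < r) (B : ℝ) :
    Integrable (fun z : (ℝ × ℝ) × ℝ => newtonKernel r ψ z.2 z.1)
      (angleMeasure.prod (volume.restrict (Set.Ioc 0 B))) := by
  rw [integrable_prod_iff' measurable_newtonKernel.aestronglyMeasurable]
  constructor
  · filter_upwards [ae_radius (r := r) B] with s hs
    exact integrable_angleMeasure_of_continuous (continuous_newtonKernel hr hs.1 hs.2)
  · have h : Integrable (fun s : ℝ => 4 * Real.pi * (s ^ 2 / max r s))
        (volume.restrict (Set.Ioc 0 B)) :=
      (((continuous_sq_div_max hr).const_mul _).continuousOn.integrableOn_compact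
        isCompact_Icc).mono_set Set.Ioc_subset_Icc_self
    refine h.congr ?_
    filter_upwards [ae_radius (r := r) B] with s hs
    rw [← integral_newtonKernel_angle (ψ := ψ) hr hs.1 hs.2]
    refine integral_congr_ae ?_
    filter_upwards [ae_angleMeasure] with x hx
    exact (Real.norm_of_nonneg (newtonKernel_nonneg s hx.1)).symm

theorem integrable_integral_newtonKernel (hr : 0 < r) {B : ℝ} (hB : 0 ≤ B) :
    Integrable (fun x => ∫ s in (0 : ℝ)..B, newtonKernel r ψ s x) angleMeasure := by
  simp only [intervalIntegral.integral_of_le hB]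
  exact (integrable_newtonKernel hr B).integral_prod_left

theorem integral_sq_div_max {B : ℝ} (hr : 0 < r) (hB : r < B) :
    ∫ s in (0 : ℝ)..B, s ^ 2 / max r s = r ^ 2 / 3 + (B ^ 2 - r ^ 2) / 2 := by
  have hc := continuous_sq_div_max hr
  rw [← intervalIntegral.integral_add_adjacent_intervals (hc.intervalIntegrable 0 r)
    (hc.intervalIntegrable r B)]
  congr 1
  · rw [intervalIntegral.integral_congr (g := fun s => s ^ 2 / r),
      intervalIntegral.integral_div, integral_pow]
    · field_simp; ring
    · intro s hs
      rw [Set.uIcc_of_le hr.le] at hs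
      simp only [max_eq_left hs.2]
  · rw [intervalIntegral.integral_congr (g := fun s => s), integral_id]
    intro s hs
    rw [Set.uIcc_of_le hB.le] at hs
    simp only [max_eq_right hs.1]
    have : 0 < s := hr.trans_le hs.1
    field_simp

/-- The interior potential of a homogeneous ball. -/
theorem integral_newtonKernel_ball {B : ℝ} (hr : 0 < r) (hB : r < B) :
    ∫ x, (∫ s in (0 : ℝ)..B, newtonKernel r ψ s x) ∂angleMeasure =
      2 * Real.pi * (3 * B ^ 2 - r ^ 2) / 3 := by
  have hB0 : 0 ≤ B := (hr.trans hB).le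
  simp only [intervalIntegral.integral_of_le hB0]
  rw [integral_integral_swap (integrable_newtonKernel hr B)]
  rw [integral_congr_ae (g := fun s => 4 * Real.pi * (s ^ 2 / max r s))]
  · rw [← intervalIntegral.integral_of_le hB0, intervalIntegral.integral_const_mul,
      integral_sq_div_max hr hB]
    ring
  · filter_upwards [ae_radius (r := r) B] with s hs
    exact integral_newtonKernel_angle hr hs.1 hs.2

theorem measurable_integral_newtonKernel {ρ : ℝ → ℝ} (hρ : Continuous ρ) :
    StronglyMeasurable fun x : ℝ × ℝ => ∫ s in (0 : ℝ)..ρ x.1, newtonKernel r ψ s x := by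
  have e : (fun x : ℝ × ℝ => ∫ s in (0 : ℝ)..ρ x.1, newtonKernel r ψ s x) =
      fun x => ρ x.1 * ∫ t in Set.Ioc (0 : ℝ) 1, newtonKernel r ψ (ρ x.1 * t) x := by
    ext x
    rw [← intervalIntegral.integral_of_le zero_le_one,
      intervalIntegral.mul_integral_comp_mul_left (f := fun s => newtonKernel r ψ s x)]
    simp
  rw [e]
  refine (hρ.comp continuous_fst).stronglyMeasurable.mul ?_
  have hm : Measurable fun z : (ℝ × ℝ) × ℝ => newtonKernel r ψ (ρ z.1.1 * z.2) z.1 :=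
    measurable_newtonKernel.comp (f := fun z : (ℝ × ℝ) × ℝ => (z.1, ρ z.1.1 * z.2))
      (by fun_prop)
  exact hm.stronglyMeasurable.integral_prod_right'

theorem abs_newtonKernel_le {s d B : ℝ} (hr : 0 < r) (hd : 0 < d) (hs : r + d ≤ s) (hB : s ≤ B)
    (x : ℝ × ℝ) : |newtonKernel r ψ s x| ≤ B ^ 2 / d := by
  have hs0 : 0 ≤ s := by linarith
  rw [newtonKernel, abs_div, abs_mul, abs_of_nonneg (sq_nonneg s),
    abs_of_nonneg (Real.sqrt_nonneg _)]
  have h1 : d ≤ Real.sqrt (r ^ 2 + s ^ 2 - 2 * r * s * sphDot ψ x.1 x.2) := by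
    refine Real.le_sqrt_of_sq_le (le_trans ?_ (sub_sq_le_dist_sq hr hs0 _ _))
    nlinarith
  refine div_le_div₀ (sq_nonneg B) ?_ hd h1
  calc s ^ 2 * |Real.sin x.1| ≤ s ^ 2 * 1 := by gcongr; exact Real.abs_sin_le_one _
    _ ≤ B ^ 2 := by rw [mul_one]; gcongr

/-- Fubini for a body whose boundary is `s = ρ α`. -/
theorem integrable_integral_newtonKernel_of_le {B : ℝ} {ρ : ℝ → ℝ} (hr : 0 < r)
    (hψ : ψ ∈ Set.Icc 0 Real.pi) (hρ : Continuous ρ) (h0 : ∀ α, 0 ≤ ρ α) (hB : ∀ α, ρ α ≤ B) :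
    Integrable (fun x : ℝ × ℝ => ∫ s in (0 : ℝ)..ρ x.1, newtonKernel r ψ s x) angleMeasure := by
  have hB0 : 0 ≤ B := (h0 0).trans (hB 0)
  refine (integrable_integral_newtonKernel (ψ := ψ) hr hB0).mono'
    (measurable_integral_newtonKernel hρ).aestronglyMeasurable ?_
  filter_upwards [ae_angleMeasure] with x hx
  have hn : ∀ s, 0 ≤ newtonKernel r ψ s x := fun s => newtonKernel_nonneg s hx.1
  rw [Real.norm_of_nonneg (intervalIntegral.integral_nonneg (h0 _) fun s _ => hn s)]
  exact intervalIntegral.integral_mono_interval le_rfl (h0 _) (hB _)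
    (Eventually.of_forall hn)
    (intervalIntegrable_newtonKernel hr hB0 (sphDot_lt_one hψ hx.1 hx.2))

/-- First variation of the interior potential of a ball under a deformation of its boundary. -/
theorem hasDerivAt_integral_newtonKernel {R : ℝ} {P : ℝ → ℝ} (hr : 0 < r) (hrR : r < R)
    (hψ : ψ ∈ Set.Icc 0 Real.pi) (hP : Continuous P) (hP1 : ∀ α, |P α| ≤ 1) :
    (∀ᶠ δ in nhds 0, Integrable (fun x : ℝ × ℝ =>
      ∫ s in (0 : ℝ)..(R * (1 + δ * P x.1)), newtonKernel r ψ s x) angleMeasure) ∧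
    HasDerivAt (fun δ => ∫ x, (∫ s in (0 : ℝ)..(R * (1 + δ * P x.1)),
      newtonKernel r ψ s x) ∂angleMeasure)
      (∫ x, newtonKernel r ψ R x * (R * P x.1) ∂angleMeasure) 0 := by
  have hR : 0 < R := hr.trans hrR
  set d := (R - r) / 2 with hd
  have hd0 : 0 < d := by rw [hd]; linarith
  have hball : ∀ δ ∈ Metric.ball (0 : ℝ) (d / R), ∀ α,
      r + d ≤ R * (1 + δ * P α) ∧ R * (1 + δ * P α) ≤ 2 * R := by
    intro δ hδ α
    rw [mem_ball_zero_iff, Real.norm_eq_abs, lt_div_iff₀ hR] at hδ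
    have h : |R * (δ * P α)| ≤ d := by
      rw [abs_mul, abs_mul, abs_of_pos hR]
      calc R * (|δ| * |P α|) ≤ R * (|δ| * 1) := by gcongr; exact hP1 α
        _ ≤ d := by linarith
    have := abs_le.mp h
    constructor <;> linarith [this.1, this.2]
  have hint : ∀ δ ∈ Metric.ball (0 : ℝ) (d / R), Integrable (fun x : ℝ × ℝ =>
      ∫ s in (0 : ℝ)..(R * (1 + δ * P x.1)), newtonKernel r ψ s x) angleMeasure := by
    intro δ hδ
    exact integrable_integral_newtonKernel_of_le (ρ := fun α => R * (1 + δ * P α)) hr hψ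
      (by fun_prop) (fun α => by linarith [(hball δ hδ α).1]) fun α => (hball δ hδ α).2
  have hmem : Metric.ball (0 : ℝ) (d / R) ∈ nhds (0 : ℝ) :=
    Metric.ball_mem_nhds _ (div_pos hd0 hR)
  refine ⟨eventually_of_mem hmem hint, ?_⟩
  have main := (hasDerivAt_integral_of_dominated_loc_of_deriv_le (μ := angleMeasure)
    (F := fun δ x => ∫ s in (0 : ℝ)..(R * (1 + δ * P x.1)), newtonKernel r ψ s x)
    (F' := fun δ x => newtonKernel r ψ (R * (1 + δ * P x.1)) x * (R * P x.1))
    (bound := fun _ => (2 * R) ^ 2 / d * R) hmem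
    (Eventually.of_forall fun δ => (measurable_integral_newtonKernel
      (ρ := fun α => R * (1 + δ * P α)) (by fun_prop)).aestronglyMeasurable)
    (hint 0 (mem_of_mem_nhds hmem)) ?_ ?_ (integrable_const _) ?_).2
  · simpa using main
  · simp only [zero_mul, add_zero, mul_one]
    exact ((continuous_newtonKernel hr hR hrR.ne).mul
      (by fun_prop : Continuous fun x : ℝ × ℝ => R * P x.1)).aestronglyMeasurable
  · refine Eventually.of_forall fun x δ hδ => ?_
    rw [Real.norm_eq_abs, abs_mul, abs_mul, abs_of_pos hR]
    have h1 := hball δ hδ x.1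
    refine mul_le_mul (abs_newtonKernel_le hr hd0 h1.1 h1.2 x) ?_ (by positivity) (by positivity)
    calc R * |P x.1| ≤ R * 1 := by gcongr; exact hP1 _
      _ = R := mul_one R
  · filter_upwards [ae_angleMeasure] with x hx δ hδ
    have hlt := sphDot_lt_one hψ hx.1 hx.2
    have h0 : 0 ≤ R * (1 + δ * P x.1) := by linarith [(hball δ hδ x.1).1]
    have hm : Measurable fun s => newtonKernel r ψ s x :=
      measurable_newtonKernel.comp (f := fun s : ℝ => (x, s)) (by fun_prop)
    have hfd := intervalIntegral.integral_hasDerivAt_right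
      (intervalIntegrable_newtonKernel hr h0 hlt)
      hm.stronglyMeasurable.stronglyMeasurableAtFilter
      (continuousAt_newtonKernel_radius hr h0 hlt)
    have hρ : HasDerivAt (fun δ => R * (1 + δ * P x.1)) (R * P x.1) δ :=
      ((((hasDerivAt_id δ).mul_const (P x.1)).const_add 1).const_mul R).congr_deriv (by simp)
    exact hfd.comp δ hρ

end potential

/-- Interior potential of a homogeneous body bounded by
`s = R(1 + δ P₂(cos α))`: for `0 < r < R`, the triple integral `F(δ)` of the
inverse distance satisfies `F(0) = 2π(3R² − r²)/3` and
`F'(0) = (4π/5) r² P₂(cos ψ)`; consequently the potential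
`V_S(δ) = −(3κM/(4πR³)) F(δ)` satisfies
`V_S = −κM((3R² − r²)/(2R³) + (3/5)(r²/R³) δ P₂(cos ψ)) + o(δ)`. -/
theorem interior_potential_deformed_body
    (R r : ℝ) (hr : 0 < r) (hrR : r < R)
    (ψ : ℝ) (hψ : ψ ∈ Set.Icc (0 : ℝ) Real.pi)
    (P₂ : ℝ → ℝ) (hP₂ : ∀ z : ℝ, P₂ z = (3 * z ^ 2 - 1) / 2)
    (F : ℝ → ℝ)
    (hF : ∀ δ : ℝ, F δ =
      ∫ α in (0:ℝ)..Real.pi, ∫ φ in (0:ℝ)..(2 * Real.pi),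
        ∫ s in (0:ℝ)..(R * (1 + δ * P₂ (Real.cos α))),
          s ^ 2 * Real.sin α /
            Real.sqrt (r ^ 2 + s ^ 2 -
              2 * r * s * (Real.cos ψ * Real.cos α +
                Real.sin ψ * Real.sin α * Real.cos φ)))
    (κ M : ℝ) (hκ : 0 < κ) (hM : 0 < M)
    (VS : ℝ → ℝ)
    (hVS : ∀ δ : ℝ, VS δ = -(3 * κ * M / (4 * Real.pi * R ^ 3)) * F δ) :
    F 0 = 2 * Real.pi * (3 * R ^ 2 - r ^ 2) / 3 ∧
      HasDerivAt F ((4 * Real.pi / 5) * r ^ 2 * P₂ (Real.cos ψ)) 0 ∧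
      (fun δ : ℝ => VS δ -
          (-(κ * M) * ((3 * R ^ 2 - r ^ 2) / (2 * R ^ 3) +
            (3 / 5) * (r ^ 2 / R ^ 3) * δ * P₂ (Real.cos ψ))))
        =o[nhds 0] fun δ : ℝ => δ := by
  have hR : 0 < R := hr.trans hrR
  have hPc : Continuous fun α => P₂ (Real.cos α) := by
    simp only [hP₂]; fun_prop
  have hP1 : ∀ α, |P₂ (Real.cos α)| ≤ 1 := by
    intro α
    rw [hP₂, abs_le]
    constructor <;> nlinarith [Real.cos_sq_le_one α, sq_nonneg (Real.cos α)]
  obtain ⟨hint, hder⟩ := hasDerivAt_integral_newtonKernel hr hrR hψ hPc hP1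
  have hFint : ∀ᶠ δ in nhds 0, F δ = ∫ x, (∫ s in (0 : ℝ)..(R * (1 + δ * P₂ (Real.cos x.1))),
      newtonKernel r ψ s x) ∂angleMeasure := by
    filter_upwards [hint] with δ hδ
    rw [hF, integral_angleMeasure hδ]
    rfl
  have hF0 : F 0 = 2 * Real.pi * (3 * R ^ 2 - r ^ 2) / 3 := by
    rw [hFint.self_of_nhds, ← integral_newtonKernel_ball (ψ := ψ) hr hrR]
    simp
  have hval : ∫ x, newtonKernel r ψ R x * (R * P₂ (Real.cos x.1)) ∂angleMeasure =
      (4 * Real.pi / 5) * r ^ 2 * P₂ (Real.cos ψ) := by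
    have hc : Continuous fun x : ℝ × ℝ => newtonKernel r ψ R x * (R * P₂ (Real.cos x.1)) :=
      (continuous_newtonKernel hr hR hrR.ne).mul ((hPc.comp continuous_fst).const_mul R)
    rw [integral_angleMeasure (integrable_angleMeasure_of_continuous hc)]
    have e : ∀ α φ, newtonKernel r ψ R (α, φ) * (R * P₂ (Real.cos α)) =
        R ^ 3 * (Real.sin α / Real.sqrt (r ^ 2 + R ^ 2 - 2 * r * R * sphDot ψ α φ) *
          ((3 * Real.cos α ^ 2 - 1) / 2)) := by
      intro α φ
      rw [hP₂, newtonKernel]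
      ring
    simp only [e, intervalIntegral.integral_const_mul,
      integral_sphere_inv_dist_mul_legendre_two hr hrR]
    rw [hP₂]
    field_simp
  have hFder : HasDerivAt F ((4 * Real.pi / 5) * r ^ 2 * P₂ (Real.cos ψ)) 0 := by
    rw [← hval]
    exact hder.congr_of_eventuallyEq hFint
  refine ⟨hF0, hFder, ?_⟩
  have ho := (hasDerivAt_iff_isLittleO.mp hFder).const_mul_left
    (-(3 * κ * M / (4 * Real.pi * R ^ 3)))
  refine (ho.congr (fun δ => ?_) fun δ => sub_zero δ)
  rw [hVS, hF0, sub_zero, smul_eq_mul]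
  have := Real.pi_pos
  field_simp
  ring
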